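/- arXiv:1402.3950 — 2 statements merged into one kernel-verified Lean document; each statement's English description precedes it below -/
import Mathlib

section
/- Define rational numbers c^k_j for integers k ≥ 1 and 0 ≤ j ≤ k−1 by the recursion c^1_0 = 1, c^{k+1}_0 = c^k_0, c^{k+1}_k = −(1/k)·c^k_{k−1}, and c^{k+1}_j = c^k_j − (1/k)·c^k_{j−1} for 1 ≤ j ≤ k−1. Then for every λ ≠ 0, every real s > 0, every integer k ≥ 1, and every z with λ·e^z > −1, one has I_k^s(z) = λ^{1−k} · Σ_{j=0}^{k−1} c^k_j · φ_s^{(j)}(z), where φ_s^{(j)} denotes the j-th derivative of φ_s (which exists on this set). Moreover c^k_0 = 1 and c^k_{k−1} = (−1)^{k−1}/(k−1)! for all k ≥ 1. -/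
open MeasureTheory Filter Set

/-- The Fermi-type integral `I_k^s(z) = (1/Γ(s)) ∫₀^∞ t^{s-1} / (e^{t-z} + λ)^k dt`. -/
noncomputable def fermiI (lam s : ℝ) (k : ℕ) (z : ℝ) : ℝ :=
  (1 / Real.Gamma s) * ∫ t in Set.Ioi (0 : ℝ), t ^ (s - 1) / (Real.exp (t - z) + lam) ^ k

/-- On `t ≥ 0` and `z ≤ w` with `λ e^w > -1`, the denominator `e^{t-z} + λ` is bounded below by
a positive multiple of `e^t`. -/
theorem exists_mul_exp_le_exp_sub_add {lam w : ℝ} (hw : lam * Real.exp w > -1) :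
    ∃ δ > 0, ∀ t z : ℝ, 0 ≤ t → z ≤ w → δ * Real.exp t ≤ Real.exp (t - z) + lam := by
  have hpos : 0 < Real.exp (-w) + lam := by
    have h : Real.exp (-w) + lam = Real.exp (-w) * (1 + lam * Real.exp w) := by
      have : Real.exp (-w) * Real.exp w = 1 := by rw [← Real.exp_add]; simp
      linear_combination -lam * this
    rw [h]
    exact mul_pos (Real.exp_pos _) (by linarith)
  refine ⟨min (Real.exp (-w)) (Real.exp (-w) + lam), lt_min (Real.exp_pos _) hpos, ?_⟩
  intro t z ht hz
  have h1 : Real.exp t * Real.exp (-w) ≤ Real.exp (t - z) := by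
    rw [← Real.exp_add]
    exact Real.exp_le_exp.2 (by linarith)
  have h2 : 1 ≤ Real.exp t := Real.one_le_exp ht
  rcases le_total 0 lam with h | h
  · rw [min_eq_left (by linarith)]
    linarith
  · rw [min_eq_right (by linarith)]
    nlinarith

theorem abs_rpow_div_exp_sub_add_pow_le {lam s δ t z : ℝ} (hδ : 0 < δ) (ht : 0 ≤ t)
    (h : δ * Real.exp t ≤ Real.exp (t - z) + lam) {k : ℕ} (hk : 1 ≤ k) :
    |t ^ (s - 1) / (Real.exp (t - z) + lam) ^ k| ≤
      (δ ^ k)⁻¹ * (Real.exp (-t) * t ^ (s - 1)) := by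
  have h0 : 0 ≤ t ^ (s - 1) := Real.rpow_nonneg ht _
  have hd : 0 < δ * Real.exp t := mul_pos hδ (Real.exp_pos _)
  have hexp : Real.exp t ≤ Real.exp t ^ k := le_self_pow₀ (Real.one_le_exp ht) (by omega)
  have hle : δ ^ k * Real.exp t ≤ (Real.exp (t - z) + lam) ^ k :=
    calc δ ^ k * Real.exp t ≤ δ ^ k * Real.exp t ^ k := by gcongr
      _ = (δ * Real.exp t) ^ k := (mul_pow _ _ _).symm
      _ ≤ _ := pow_le_pow_left₀ hd.le h k
  rw [abs_of_nonneg (div_nonneg h0 (pow_nonneg (hd.le.trans h) _))]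
  calc t ^ (s - 1) / (Real.exp (t - z) + lam) ^ k
      ≤ t ^ (s - 1) / (δ ^ k * Real.exp t) := by gcongr
    _ = _ := by rw [Real.exp_neg]; field_simp

theorem aestronglyMeasurable_fermiI_integrand (lam s z : ℝ) (k : ℕ) :
    AEStronglyMeasurable (fun t : ℝ => t ^ (s - 1) / (Real.exp (t - z) + lam) ^ k)
      (volume.restrict (Ioi 0)) :=
  Measurable.aestronglyMeasurable (by fun_prop)

theorem integrableOn_fermiI_integrand {lam s z : ℝ} (hs : 0 < s) (hz : lam * Real.exp z > -1)
    {k : ℕ} (hk : 1 ≤ k) :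
    IntegrableOn (fun t : ℝ => t ^ (s - 1) / (Real.exp (t - z) + lam) ^ k) (Ioi 0) := by
  obtain ⟨δ, hδ, hb⟩ := exists_mul_exp_le_exp_sub_add hz
  refine ((Real.GammaIntegral_convergent hs).const_mul (δ ^ k)⁻¹).mono'
    (aestronglyMeasurable_fermiI_integrand lam s z k) ?_
  filter_upwards [ae_restrict_mem measurableSet_Ioi] with t ht
  exact abs_rpow_div_exp_sub_add_pow_le hδ (le_of_lt ht) (hb t z (le_of_lt ht) le_rfl) hk

theorem isOpen_setOf_mul_exp_gt (lam : ℝ) : IsOpen {z : ℝ | lam * Real.exp z > -1} :=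
  isOpen_lt continuous_const (by fun_prop)

theorem hasDerivAt_fermiI {lam s z : ℝ} (hs : 0 < s) (hz : lam * Real.exp z > -1)
    {k : ℕ} (hk : 1 ≤ k) :
    HasDerivAt (fermiI lam s k)
      (k * fermiI lam s k z - k * lam * fermiI lam s (k + 1) z) z := by
  obtain ⟨w, hzw, hw⟩ : ∃ w, z < w ∧ lam * Real.exp w > -1 := by
    have h := (isOpen_setOf_mul_exp_gt lam).mem_nhds hz
    obtain ⟨w, hw, hzw⟩ := Filter.nonempty_of_mem
      (inter_mem (mem_nhdsWithin_of_mem_nhds h) (self_mem_nhdsWithin (s := Ioi z)))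
    exact ⟨w, hzw, hw⟩
  obtain ⟨δ, hδ, hb⟩ := exists_mul_exp_le_exp_sub_add hw
  have hG := Real.GammaIntegral_convergent hs
  have hi := integrableOn_fermiI_integrand hs hz hk
  have hi' := integrableOn_fermiI_integrand hs hz (Nat.le_add_left 1 k)
  have key := hasDerivAt_integral_of_dominated_loc_of_deriv_le
    (μ := volume.restrict (Ioi (0 : ℝ))) (𝕜 := ℝ)
    (F := fun x t => t ^ (s - 1) / (Real.exp (t - x) + lam) ^ k)
    (F' := fun x t => k * (t ^ (s - 1) / (Real.exp (t - x) + lam) ^ k)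
      - k * lam * (t ^ (s - 1) / (Real.exp (t - x) + lam) ^ (k + 1)))
    (bound := fun t => k * ((δ ^ k)⁻¹ * (Real.exp (-t) * t ^ (s - 1)))
      + k * |lam| * ((δ ^ (k + 1))⁻¹ * (Real.exp (-t) * t ^ (s - 1))))
    (Iio_mem_nhds hzw)
    (Eventually.of_forall fun x => aestronglyMeasurable_fermiI_integrand lam s x k)
    hi
    (((hi.const_mul (k : ℝ)).sub (hi'.const_mul (k * lam))).aestronglyMeasurable)
    ?_
    (((hG.const_mul _).const_mul _).add ((hG.const_mul _).const_mul _))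
    ?_
  · have h := key.2.const_mul (1 / Real.Gamma s)
    rw [integral_sub (hi.const_mul _) (hi'.const_mul _), integral_const_mul,
      integral_const_mul] at h
    refine HasDerivAt.congr_deriv (f := fermiI lam s k) h ?_
    unfold fermiI
    ring
  · filter_upwards [ae_restrict_mem measurableSet_Ioi] with t ht x hx
    have hbx := hb t x (le_of_lt ht) (le_of_lt hx)
    have h1 := abs_rpow_div_exp_sub_add_pow_le (s := s) hδ (le_of_lt ht) hbx hk
    have h2 := abs_rpow_div_exp_sub_add_pow_le (s := s) hδ (le_of_lt ht) hbx
      (Nat.le_add_left 1 k)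
    refine (norm_sub_le _ _).trans ?_
    rw [Real.norm_eq_abs, Real.norm_eq_abs, abs_mul, abs_mul _ (_ / _), abs_mul (k : ℝ) lam,
      Nat.abs_cast]
    gcongr
  · filter_upwards [ae_restrict_mem measurableSet_Ioi] with t ht x hx
    have hpos : 0 < Real.exp (t - x) + lam :=
      (mul_pos hδ (Real.exp_pos t)).trans_le (hb t x (le_of_lt ht) (le_of_lt hx))
    have hd : HasDerivAt (fun x => Real.exp (t - x) + lam) (-Real.exp (t - x)) x := by
      simpa using (((hasDerivAt_id x).const_sub t).exp).add_const lam
    have h := ((hd.pow k).inv (pow_pos hpos k).ne').const_mul (t ^ (s - 1))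
    simp only [div_eq_mul_inv]
    refine h.congr_deriv ?_
    obtain ⟨m, rfl⟩ : ∃ m, k = m + 1 := ⟨k - 1, by omega⟩
    simp only [Pi.pow_apply, Nat.add_sub_cancel]
    field_simp
    ring

theorem contDiffOn_fermiI {lam s : ℝ} (hs : 0 < s) (n : ℕ) {k : ℕ} (hk : 1 ≤ k) :
    ContDiffOn ℝ n (fermiI lam s k) {z : ℝ | lam * Real.exp z > -1} := by
  induction n generalizing k with
  | zero =>
    exact contDiffOn_zero.2 fun z hz =>
      (hasDerivAt_fermiI hs hz hk).continuousAt.continuousWithinAt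
  | succ n ih =>
    push_cast
    rw [contDiffOn_succ_iff_deriv_of_isOpen (isOpen_setOf_mul_exp_gt lam)]
    refine ⟨fun z hz => (hasDerivAt_fermiI hs hz hk).differentiableAt.differentiableWithinAt,
      by simp, ?_⟩
    exact ((contDiffOn_const.mul (ih hk)).sub
      (contDiffOn_const.mul (ih (Nat.le_add_left 1 k)))).congr
      fun z hz => (hasDerivAt_fermiI hs hz hk).deriv

theorem differentiableAt_iteratedDeriv_fermiI {lam s z : ℝ} (hs : 0 < s)
    (hz : lam * Real.exp z > -1) {k : ℕ} (hk : 1 ≤ k) (j : ℕ) :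
    DifferentiableAt ℝ (iteratedDeriv j (fermiI lam s k)) z := by
  have hU := isOpen_setOf_mul_exp_gt lam
  have h := (contDiffOn_fermiI hs (j + 1) hk).differentiableOn_iteratedDerivWithin
    (m := j) (by exact_mod_cast Nat.lt_succ_self j) hU.uniqueDiffOn
  exact (h.congr fun x hx => (iteratedDerivWithin_of_isOpen hU hx).symm).differentiableAt
    (hU.mem_nhds hz)

theorem sum_range_succ_of_recursion {c : ℕ → ℕ → ℚ} {k : ℕ} (hk : 1 ≤ k)
    (h0 : c (k + 1) 0 = c k 0)
    (htop : c (k + 1) k = -(1 / (k : ℚ)) * c k (k - 1))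
    (hmid : ∀ j : ℕ, 1 ≤ j → j ≤ k - 1 → c (k + 1) j = c k j - (1 / (k : ℚ)) * c k (j - 1))
    (D : ℕ → ℝ) :
    ∑ j ∈ Finset.range (k + 1), (c (k + 1) j : ℝ) * D j =
      ∑ j ∈ Finset.range k, (c k j : ℝ) * D j
        - (1 / (k : ℝ)) * ∑ j ∈ Finset.range k, (c k j : ℝ) * D (j + 1) := by
  obtain ⟨m, rfl⟩ : ∃ m, k = m + 1 := ⟨k - 1, by omega⟩
  have hsum : ∑ j ∈ Finset.range m, (c (m + 1 + 1) (j + 1) : ℝ) * D (j + 1) =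
      ∑ j ∈ Finset.range m, (c (m + 1) (j + 1) : ℝ) * D (j + 1)
        - (1 / ((m + 1 : ℕ) : ℝ)) * ∑ j ∈ Finset.range m, (c (m + 1) j : ℝ) * D (j + 1) := by
    rw [Finset.mul_sum, ← Finset.sum_sub_distrib]
    refine Finset.sum_congr rfl fun j hj => ?_
    have := Finset.mem_range.1 hj
    rw [hmid (j + 1) (by omega) (by omega)]
    push_cast
    ring
  rw [Finset.sum_range_succ, Finset.sum_range_succ', hsum, h0, htop,
    Finset.sum_range_succ' (fun j => (c (m + 1) j : ℝ) * D j),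
    Finset.sum_range_succ (fun j => (c (m + 1) j : ℝ) * D (j + 1))]
  push_cast
  ring

/-- If the rational coefficients `c^k_j` satisfy the recursion
`c^1_0 = 1`, `c^{k+1}_0 = c^k_0`, `c^{k+1}_k = -(1/k) c^k_{k-1}` and
`c^{k+1}_j = c^k_j - (1/k) c^k_{j-1}` for `1 ≤ j ≤ k-1`, then
`I_k^s(z) = λ^{1-k} Σ_{j=0}^{k-1} c^k_j φ_s^{(j)}(z)` (where all the iterated
derivatives of `φ_s = I_1^s` exist on `{z | λ e^z > -1}`), and moreover
`c^k_0 = 1` and `c^k_{k-1} = (-1)^{k-1}/(k-1)!`. -/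
theorem fermiI_polylog_expansion (c : ℕ → ℕ → ℚ)
    (h10 : c 1 0 = 1)
    (hrec0 : ∀ k : ℕ, 1 ≤ k → c (k + 1) 0 = c k 0)
    (hrectop : ∀ k : ℕ, 1 ≤ k → c (k + 1) k = -(1 / (k : ℚ)) * c k (k - 1))
    (hrecmid : ∀ k : ℕ, 1 ≤ k → ∀ j : ℕ, 1 ≤ j → j ≤ k - 1 →
      c (k + 1) j = c k j - (1 / (k : ℚ)) * c k (j - 1)) :
    (∀ lam : ℝ, lam ≠ 0 → ∀ s : ℝ, 0 < s → ∀ k : ℕ, 1 ≤ k →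
      ∀ z : ℝ, lam * Real.exp z > -1 →
        (∀ j : ℕ, DifferentiableAt ℝ (iteratedDeriv j (fermiI lam s 1)) z) ∧
        fermiI lam s k z = lam ^ (1 - (k : ℤ)) *
          ∑ j ∈ Finset.range k, (c k j : ℝ) * iteratedDeriv j (fermiI lam s 1) z) ∧
    (∀ k : ℕ, 1 ≤ k →
      c k 0 = 1 ∧ c k (k - 1) = (-1) ^ (k - 1) / (Nat.factorial (k - 1) : ℚ)) := by
  refine ⟨fun lam hlam s hs k hk z hz =>
    ⟨differentiableAt_iteratedDeriv_fermiI hs hz le_rfl, ?_⟩, fun k hk => ?_⟩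
  · induction k, hk using Nat.le_induction generalizing z with
    | base => simp [h10]
    | succ k hk ih =>
      have hk0 : (k : ℝ) ≠ 0 := by positivity
      have hd : HasDerivAt (fermiI lam s k) (lam ^ (1 - (k : ℤ)) *
          ∑ j ∈ Finset.range k, (c k j : ℝ) * iteratedDeriv (j + 1) (fermiI lam s 1) z) z := by
        refine HasDerivAt.congr_of_eventuallyEq (HasDerivAt.const_mul _
          (HasDerivAt.fun_sum fun j _ => HasDerivAt.const_mul _ ?_))
          (eventuallyEq_of_mem ((isOpen_setOf_mul_exp_gt lam).mem_nhds hz) ih)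
        rw [iteratedDeriv_succ]
        exact (differentiableAt_iteratedDeriv_fermiI hs hz le_rfl j).hasDerivAt
      have heq := (hasDerivAt_fermiI hs hz hk).unique hd
      have hpow : lam ^ (1 - (k : ℤ)) = lam * lam ^ (1 - ((k + 1 : ℕ) : ℤ)) := by
        rw [← zpow_one_add₀ hlam]
        push_cast
        ring_nf
      rw [sum_range_succ_of_recursion hk (hrec0 k hk) (hrectop k hk) (hrecmid k hk)]
      rw [ih z hz, hpow] at heq
      refine mul_left_cancel₀ (mul_ne_zero hk0 hlam) ?_
      field_simp at heq ⊢
      linear_combination -heq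
  · induction k, hk using Nat.le_induction with
    | base => simp [h10]
    | succ k hk ih =>
      obtain ⟨m, rfl⟩ : ∃ m, k = m + 1 := ⟨k - 1, by omega⟩
      refine ⟨(hrec0 _ hk).trans ih.1, ?_⟩
      simp only [Nat.add_sub_cancel] at ih ⊢
      rw [hrectop _ hk, Nat.add_sub_cancel, ih.2, Nat.factorial_succ]
      push_cast
      field_simp
      ring
end

section
/- Let d ≥ 1 be an integer, T > 0, A ∈ ℝ and λ ∈ ℝ with λ·e^{A/T} > −1. Then ∫_{ℝ^d} (F_1(q) − 2·F_2(q)) dq = −n_d · φ_{d/2}''(A/T), where φ_{d/2}'' is the second derivative of the function z ↦ φ_{d/2}(z) := (1/Γ(d/2)) ∫₀^∞ t^{d/2−1}/(e^{t−z} + λ) dt (which is twice differentiable on the set where λ·e^z > −1). -/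
open MeasureTheory Filter Set

section

open Real Topology

/-- The kernel `e^{k(t-z)} / (e^{t-z} + λ)^{k+1}`. -/
noncomputable def fermiKernel (lam : ℝ) (k : ℕ) (z t : ℝ) : ℝ :=
  exp (t - z) ^ k / (exp (t - z) + lam) ^ (k + 1)

lemma neg_one_lt_mul_exp_iff {lam z : ℝ} : lam * exp z > -1 ↔ 0 < exp (-z) + lam := by
  have h : exp (-z) * exp z = 1 := by rw [← exp_add]; simp
  have hz := exp_pos z
  rw [← mul_pos_iff_of_pos_right (a := exp (-z) + lam) hz, add_mul, h]
  constructor <;> intro <;> linarith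

lemma mul_exp_le_exp_sub_add {lam p z t : ℝ} (ht : 0 ≤ t) (h₁ : p ≤ exp (-z))
    (h₂ : p ≤ exp (-z) + lam) : p * exp t ≤ exp (t - z) + lam := by
  rw [sub_eq_add_neg, exp_add]
  have h1 : 1 ≤ exp t := one_le_exp ht
  rcases le_total 0 lam with h | h <;> nlinarith

lemma abs_fermiKernel_le {lam p M z t : ℝ} (k : ℕ) (ht : 0 ≤ t) (hp : 0 < p)
    (h₁ : p ≤ exp (-z)) (h₂ : p ≤ exp (-z) + lam) (hM : exp (-z) ≤ M) :
    |fermiKernel lam k z t| ≤ M ^ k / p ^ (k + 1) * exp (-t) := by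
  have hle := mul_exp_le_exp_sub_add ht h₁ h₂
  have hpt : 0 < p * exp t := by positivity
  have hE : exp (t - z) ≤ M * exp t := by
    rw [sub_eq_add_neg, exp_add, mul_comm]
    gcongr
  have hpos : 0 < exp (t - z) + lam := hpt.trans_le hle
  have hM0 : 0 < M := (exp_pos _).trans_le hM
  rw [fermiKernel, abs_of_nonneg (by positivity)]
  calc exp (t - z) ^ k / (exp (t - z) + lam) ^ (k + 1)
      ≤ (M * exp t) ^ k / (p * exp t) ^ (k + 1) := by gcongr
    _ = M ^ k / p ^ (k + 1) * exp (-t) := by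
      rw [exp_neg, mul_pow, mul_pow, pow_succ (exp t)]
      field_simp

lemma hasDerivAt_fermiKernel {lam z t : ℝ} (k : ℕ) (h : 0 < exp (t - z) + lam) :
    HasDerivAt (fun z ↦ fermiKernel lam k z t)
      (-k * fermiKernel lam k z t + (k + 1) * fermiKernel lam (k + 1) z t) z := by
  have hE : HasDerivAt (fun z ↦ exp (t - z)) (-exp (t - z)) z := by
    simpa using ((hasDerivAt_id z).const_sub t).exp
  have := (hE.fun_pow k).fun_div ((hE.add_const lam).fun_pow (k + 1)) (by positivity)
  refine this.congr_deriv ?_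
  simp only [fermiKernel]
  rcases k with _ | k
  · simp
  · simp only [Nat.add_sub_cancel]
    push_cast
    field_simp
    ring

lemma aestronglyMeasurable_rpow_mul_fermiKernel (lam s : ℝ) (k : ℕ) (z : ℝ) :
    AEStronglyMeasurable (fun t ↦ t ^ (s - 1) * fermiKernel lam k z t)
      (volume.restrict (Ioi 0)) := by
  unfold fermiKernel
  exact Measurable.aestronglyMeasurable (by fun_prop)

lemma integrableOn_rpow_mul_exp_neg {s : ℝ} (hs : 0 < s) (C : ℝ) :
    IntegrableOn (fun t ↦ t ^ (s - 1) * (C * exp (-t))) (Ioi 0) := by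
  refine ((GammaIntegral_convergent hs).const_mul C).congr (ae_of_all _ fun t ↦ ?_)
  simp only
  ring

lemma integrableOn_rpow_mul_fermiKernel {lam s z : ℝ} (hs : 0 < s) (k : ℕ)
    (hz : 0 < exp (-z) + lam) :
    IntegrableOn (fun t ↦ t ^ (s - 1) * fermiKernel lam k z t) (Ioi 0) := by
  have hp : 0 < min (exp (-z)) (exp (-z) + lam) := lt_min (exp_pos _) hz
  refine Integrable.mono' (integrableOn_rpow_mul_exp_neg hs
      (exp (-z) ^ k / min (exp (-z)) (exp (-z) + lam) ^ (k + 1)))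
    (aestronglyMeasurable_rpow_mul_fermiKernel lam s k z)
    ((ae_restrict_iff' measurableSet_Ioi).2 (ae_of_all _ fun t (ht : 0 < t) ↦ ?_))
  rw [norm_mul, norm_of_nonneg (rpow_nonneg ht.le _)]
  gcongr
  exact abs_fermiKernel_le k ht.le hp (min_le_left _ _) (min_le_right _ _) le_rfl

/-- Differentiation of the Fermi-type integrals under the integral sign. -/
lemma hasDerivAt_integral_fermiKernel {lam s z : ℝ} (hs : 0 < s) (k : ℕ)
    (hz : 0 < exp (-z) + lam) :
    HasDerivAt (fun z ↦ ∫ t in Ioi (0 : ℝ), t ^ (s - 1) * fermiKernel lam k z t)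
      (∫ t in Ioi (0 : ℝ), t ^ (s - 1) *
        (-k * fermiKernel lam k z t + (k + 1) * fermiKernel lam (k + 1) z t)) z := by
  obtain ⟨p, hp, hpm⟩ := exists_between (lt_min (exp_pos (-z)) hz)
  obtain ⟨hp₁, hp₂⟩ := lt_min_iff.1 hpm
  obtain ⟨M, hM⟩ := exists_gt (exp (-z))
  have hcont : ContinuousAt (fun x : ℝ ↦ exp (-x)) z := by fun_prop
  have hU : {x : ℝ | p ≤ exp (-x) ∧ p ≤ exp (-x) + lam ∧ exp (-x) ≤ M} ∈ 𝓝 z := by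
    filter_upwards [hcont.eventually_const_lt hp₁,
      (hcont.add_const lam).eventually_const_lt hp₂, hcont.eventually_lt_const hM]
      with x h₁ h₂ h₃ using ⟨h₁.le, h₂.le, h₃.le⟩
  refine (hasDerivAt_integral_of_dominated_loc_of_deriv_le (F' := fun x t ↦ t ^ (s - 1) *
    (-k * fermiKernel lam k x t + (k + 1) * fermiKernel lam (k + 1) x t))
    (bound := fun t ↦ t ^ (s - 1) *
    ((k * (M ^ k / p ^ (k + 1)) + (k + 1) * (M ^ (k + 1) / p ^ (k + 2))) * exp (-t))) hU
    (.of_forall fun x ↦ aestronglyMeasurable_rpow_mul_fermiKernel lam s k x)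
    (integrableOn_rpow_mul_fermiKernel hs k hz) ?_ ?_ (integrableOn_rpow_mul_exp_neg hs _) ?_).2
  · unfold fermiKernel
    exact Measurable.aestronglyMeasurable (by fun_prop)
  · refine (ae_restrict_iff' measurableSet_Ioi).2
      (ae_of_all _ fun t (ht : 0 < t) x ⟨h₁, h₂, h₃⟩ ↦ ?_)
    rw [norm_mul, norm_of_nonneg (rpow_nonneg ht.le _)]
    have hk : (0 : ℝ) ≤ k := k.cast_nonneg
    have b₁ := abs_fermiKernel_le k ht.le hp h₁ h₂ h₃
    have b₂ := abs_fermiKernel_le (k + 1) ht.le hp h₁ h₂ h₃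
    gcongr
    refine (norm_add_le _ _).trans ?_
    rw [norm_mul, norm_mul, norm_neg, norm_of_nonneg hk,
      norm_of_nonneg (add_nonneg hk zero_le_one), Real.norm_eq_abs, Real.norm_eq_abs]
    linarith [mul_le_mul_of_nonneg_left b₁ hk,
      mul_le_mul_of_nonneg_left b₂ (add_nonneg hk zero_le_one)]
  · refine (ae_restrict_iff' measurableSet_Ioi).2
      (ae_of_all _ fun t (ht : 0 < t) x ⟨h₁, h₂, _⟩ ↦ ?_)
    exact (hasDerivAt_fermiKernel k ((mul_pos hp (exp_pos t)).trans_le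
      (mul_exp_le_exp_sub_add ht.le h₁ h₂))).const_mul _

lemma fermiI_one_eq (lam s : ℝ) : fermiI lam s 1 = fun z ↦
    (1 / Gamma s) * ∫ t in Ioi (0 : ℝ), t ^ (s - 1) * fermiKernel lam 0 z t := by
  ext z
  simp [fermiI, fermiKernel, div_eq_mul_inv]

lemma hasDerivAt_fermiI_one {lam s z : ℝ} (hs : 0 < s) (hz : 0 < exp (-z) + lam) :
    HasDerivAt (fermiI lam s 1)
      ((1 / Gamma s) * ∫ t in Ioi (0 : ℝ), t ^ (s - 1) * fermiKernel lam 1 z t) z := by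
  rw [fermiI_one_eq]
  simpa using (hasDerivAt_integral_fermiKernel hs 0 hz).const_mul (1 / Gamma s)

lemma hasDerivAt_deriv_fermiI_one {lam s z : ℝ} (hs : 0 < s) (hz : 0 < exp (-z) + lam) :
    HasDerivAt (deriv (fermiI lam s 1))
      ((1 / Gamma s) * ∫ t in Ioi (0 : ℝ), t ^ (s - 1) *
        (-fermiKernel lam 1 z t + 2 * fermiKernel lam 2 z t)) z := by
  have h := (hasDerivAt_integral_fermiKernel hs 1 hz).const_mul (1 / Gamma s)
  norm_num only [Nat.cast_one, neg_one_mul] at h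
  refine h.congr_of_eventuallyEq ?_
  have hcont : ContinuousAt (fun x : ℝ ↦ exp (-x) + lam) z := by fun_prop
  filter_upwards [hcont.eventually_const_lt hz] with x hx
  simpa using (hasDerivAt_fermiI_one hs hx).deriv

lemma integral_Ioi_pow_mul_comp_sq {d : ℕ} (hd : 1 ≤ d) {T : ℝ} (hT : 0 < T) (g : ℝ → ℝ) :
    ∫ r in Ioi (0 : ℝ), r ^ (d - 1) * g (r ^ 2 / (2 * T)) =
      (2 * T) ^ ((d : ℝ) / 2) / 2 * ∫ t in Ioi (0 : ℝ), t ^ ((d : ℝ) / 2 - 1) * g t := by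
  have hT2 : 0 < 2 * T := by positivity
  have h₁ := integral_comp_mul_left_Ioi' (fun t ↦ t ^ ((d : ℝ) / 2 - 1) * g t) 0
    (inv_pos.2 hT2)
  rw [mul_zero, ← integral_comp_rpow_Ioi_of_pos (p := 2) two_pos] at h₁
  rw [← h₁, smul_eq_mul, ← integral_const_mul, ← integral_const_mul]
  refine setIntegral_congr_fun measurableSet_Ioi fun r (hr : 0 < r) ↦ ?_
  have hg : (2 * T)⁻¹ * r ^ (2 : ℝ) = r ^ 2 / (2 * T) := by
    rw [rpow_two]; ring
  have hpow : ((2 * T)⁻¹ * r ^ (2 : ℝ)) ^ ((d : ℝ) / 2 - 1) =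
      (2 * T) * ((2 * T) ^ ((d : ℝ) / 2))⁻¹ * (r ^ (d - 1) / r) := by
    rw [mul_rpow (by positivity) (by positivity), ← rpow_mul hr.le, inv_rpow hT2.le,
      rpow_sub hT2, rpow_one, inv_div, div_eq_mul_inv,
      show (2 : ℝ) * ((d : ℝ) / 2 - 1) = ((d - 1 : ℕ) : ℝ) - 1 by push_cast [hd]; ring,
      rpow_sub hr, rpow_one, rpow_natCast]
  have hne : (2 * T) ^ ((d : ℝ) / 2) ≠ 0 := (rpow_pos_of_pos hT2 _).ne'
  simp only [smul_eq_mul]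
  rw [hpow, hg, show (2 : ℝ) - 1 = 1 by norm_num, rpow_one]
  field_simp

/-- Polar coordinates for functions of `|q|² / (2T)`. -/
lemma integral_comp_norm_sq_div {d : ℕ} (hd : 1 ≤ d) {T : ℝ} (hT : 0 < T) (g : ℝ → ℝ) :
    ∫ q : EuclideanSpace ℝ (Fin d), g (‖q‖ ^ 2 / (2 * T)) =
      (2 * π * T) ^ ((d : ℝ) / 2) *
        ((1 / Gamma ((d : ℝ) / 2)) * ∫ t in Ioi (0 : ℝ), t ^ ((d : ℝ) / 2 - 1) * g t) := by
  have : Nonempty (Fin d) := ⟨⟨0, hd⟩⟩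
  have hd' : (0 : ℝ) < (d : ℝ) / 2 := by
    have : (0 : ℝ) < d := by exact_mod_cast hd
    positivity
  have hΓ : 0 < Gamma ((d : ℝ) / 2) := Gamma_pos_of_pos hd'
  have hball : volume.real (Metric.ball (0 : EuclideanSpace ℝ (Fin d)) 1) =
      π ^ ((d : ℝ) / 2) / (d / 2 * Gamma ((d : ℝ) / 2)) := by
    rw [Measure.real, EuclideanSpace.volume_ball, Fintype.card_fin, Gamma_add_one hd'.ne',
      ENNReal.ofReal_one, one_pow, one_mul, ENNReal.toReal_ofReal (by positivity),
      sqrt_eq_rpow, ← rpow_natCast, ← rpow_mul pi_nonneg]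
    ring_nf
  have hsplit : (2 * π * T) ^ ((d : ℝ) / 2) = π ^ ((d : ℝ) / 2) * (2 * T) ^ ((d : ℝ) / 2) := by
    rw [← mul_rpow pi_nonneg (by positivity)]
    ring_nf
  rw [integral_fun_norm_addHaar volume (fun r ↦ g (r ^ 2 / (2 * T))), finrank_euclideanSpace,
    Fintype.card_fin, hball, hsplit]
  simp only [smul_eq_mul, nsmul_eq_mul]
  rw [integral_Ioi_pow_mul_comp_sq hd hT]
  field_simp

end

/-- With `h(q) = |q|²/(2T) - A/T` and `F_k = e^{kh}/(e^h + λ)^{k+1}`, one has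
`∫_{ℝ^d} (F_1 - 2F_2) dq = -n_d φ_{d/2}''(A/T)` where `φ_{d/2} = I_1^{d/2}` is twice
differentiable on `{z | λ e^z > -1}` and `n_d = (2πT)^{d/2}`. -/
theorem integral_F1_sub_two_F2 (d : ℕ) (hd : 1 ≤ d) (T : ℝ) (hT : 0 < T)
    (A lam : ℝ) (hz : lam * Real.exp (A / T) > -1)
    (h : EuclideanSpace ℝ (Fin d) → ℝ)
    (hh : ∀ q, h q = ‖q‖ ^ 2 / (2 * T) - A / T)
    (F : ℕ → EuclideanSpace ℝ (Fin d) → ℝ)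
    (hF : ∀ (k : ℕ) q, F k q = Real.exp (k * h q) / (Real.exp (h q) + lam) ^ (k + 1)) :
    (∀ z : ℝ, lam * Real.exp z > -1 →
      DifferentiableAt ℝ (fermiI lam ((d : ℝ) / 2) 1) z) ∧
    (∀ z : ℝ, lam * Real.exp z > -1 →
      DifferentiableAt ℝ (deriv (fermiI lam ((d : ℝ) / 2) 1)) z) ∧
    (∫ q : EuclideanSpace ℝ (Fin d), (F 1 q - 2 * F 2 q))
      = -((2 * Real.pi * T) ^ ((d : ℝ) / 2)) *
        deriv (deriv (fermiI lam ((d : ℝ) / 2) 1)) (A / T) := by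
  have hs : (0 : ℝ) < (d : ℝ) / 2 := by
    have : (0 : ℝ) < d := by exact_mod_cast hd
    positivity
  refine ⟨fun z hz ↦ (hasDerivAt_fermiI_one hs (neg_one_lt_mul_exp_iff.1 hz)).differentiableAt,
    fun z hz ↦ (hasDerivAt_deriv_fermiI_one hs (neg_one_lt_mul_exp_iff.1 hz)).differentiableAt, ?_⟩
  have hint : ∀ q, F 1 q - 2 * F 2 q = (fun t ↦ fermiKernel lam 1 (A / T) t -
      2 * fermiKernel lam 2 (A / T) t) (‖q‖ ^ 2 / (2 * T)) := fun q ↦ by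
    simp only [hF, hh, fermiKernel, Real.exp_nat_mul]
  rw [integral_congr_ae (ae_of_all _ hint), integral_comp_norm_sq_div hd hT
    (fun t ↦ fermiKernel lam 1 (A / T) t - 2 * fermiKernel lam 2 (A / T) t), neg_mul, ← mul_neg,
    (hasDerivAt_deriv_fermiI_one hs (neg_one_lt_mul_exp_iff.1 hz)).deriv, ← mul_neg,
    ← integral_neg]
  congr! 4
  ring
end
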